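/- arXiv:2303.07947 — 9 statements merged into one kernel-verified Lean document; each statement's English description precedes it below -/
import Mathlib

section
/- For all integers n, k with 1 ≤ k ≤ n−1, the simplex sphere family B'(n,k) is a basis of the ℤ/2-cycle space Z_k of the n-simplex; that is, the chains ∂c, as c ranges over the (k+2)-element subsets of Fin (n+1) containing the vertex 0, form a linearly independent spanning set of the kernel of ∂_k. -/
open Finset

/-- A `k`-cell of the `n`-simplex `Δₙ`: a `(k+1)`-element subset of the vertex set `Fin (n+1)`. -/
abbrev SimplexCell (n k : ℕ) := {s : Finset (Fin (n + 1)) // s.card = k + 1}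

/-- The `ℤ/2`-vector space `Cₖ` of mod-2 `k`-chains of the `n`-simplex. -/
abbrev SimplexChain (n k : ℕ) := SimplexCell n k → ZMod 2

/-- The mod-2 boundary map `∂ₖ : Cₖ → C_{k-1}`: the indicator of a `(k+1)`-element subset `s`
is sent to the sum of the indicators of the `k`-element subsets of `s`.  Equivalently (by
`ℤ/2`-linearity), the coefficient of a `(k-1)`-cell `t` in `∂ₖ x` is the sum of `x s` over
the `k`-cells `s` with `t ⊆ s`. -/
def simplexBoundary (n k : ℕ) : SimplexChain n k →ₗ[ZMod 2] SimplexChain n (k - 1) where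
  toFun x t := ∑ s ∈ univ.filter (fun s : SimplexCell n k => t.1 ⊆ s.1), x s
  map_add' x y := by funext t; exact Finset.sum_add_distrib
  map_smul' c x := by funext t; simp [Finset.mul_sum]

/-- `∂c` for a `(k+2)`-element vertex subset `c`: the boundary `∂_{k+1}` of the indicator of
the `(k+1)`-simplex with vertex set `c`; it is a `k`-chain (a `k`-dimensional sphere). -/
def simplexSphere (n k : ℕ) (c : Finset (Fin (n + 1))) : SimplexChain n k :=
  simplexBoundary n (k + 1) (fun s : SimplexCell n (k + 1) => if s.1 = c then 1 else 0)

theorem simplexBoundary_apply (n k : ℕ) (x : SimplexChain n k) (t : SimplexCell n (k - 1)) :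
    simplexBoundary n k x t =
      ∑ s ∈ univ.filter (fun s : SimplexCell n k => t.1 ⊆ s.1), x s := rfl

theorem simplexSphere_apply {n k : ℕ} {c : Finset (Fin (n + 1))} (hc : c.card = k + 2)
    (s : SimplexCell n k) : simplexSphere n k c s = if s.1 ⊆ c then 1 else 0 := by
  have h : simplexSphere n k c s =
      ∑ u ∈ univ.filter (fun u : SimplexCell n (k + 1) => s.1 ⊆ u.1),
        if u = ⟨c, hc⟩ then (1 : ZMod 2) else 0 :=
    (simplexBoundary_apply n (k + 1) _ s).trans
      (Finset.sum_congr rfl fun u _ => by simp only [Subtype.ext_iff])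
  rw [h, Finset.sum_ite_eq']
  simp

/-- Exactly two `(k+1)`-cells lie between a `k`-cell and a `(k+2)`-cell containing it. -/
theorem card_cells_between {n k : ℕ} {t c : Finset (Fin (n + 1))} (ht : t.card = k)
    (hc : c.card = k + 2) (htc : t ⊆ c) :
    (univ.filter (fun s : SimplexCell n k => t ⊆ s.1 ∧ s.1 ⊆ c)).card = 2 := by
  have hd : (c \ t).card = 2 := by rw [Finset.card_sdiff_of_subset htc]; omega
  rw [← hd]
  symm
  refine Finset.card_bij
    (fun a ha => ⟨insert a t, by
      rw [Finset.card_insert_of_notMem (Finset.mem_sdiff.1 ha).2, ht]⟩) ?_ ?_ ?_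
  · intro a ha
    simp only [mem_filter, mem_univ, true_and]
    exact ⟨Finset.subset_insert _ _, Finset.insert_subset (Finset.mem_sdiff.1 ha).1 htc⟩
  · intro a ha b _ hab
    have h : a ∈ insert b t := by
      have hab' : insert a t = insert b t := Subtype.ext_iff.1 hab
      exact hab' ▸ Finset.mem_insert_self a t
    exact (Finset.mem_insert.1 h).resolve_right (Finset.mem_sdiff.1 ha).2
  · rintro ⟨s, hs⟩ h
    simp only [mem_filter, mem_univ, true_and] at h
    obtain ⟨a, ha, rfl⟩ := Finset.exists_eq_insert_iff.2 ⟨h.1, by rw [ht, hs]⟩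
    exact ⟨a, Finset.mem_sdiff.2 ⟨h.2 (Finset.mem_insert_self _ _), ha⟩, rfl⟩

theorem simplexSphere_mem_ker {n k : ℕ} (hk : 1 ≤ k) {c : Finset (Fin (n + 1))}
    (hc : c.card = k + 2) : simplexSphere n k c ∈ LinearMap.ker (simplexBoundary n k) := by
  rw [LinearMap.mem_ker]
  funext t
  have ht : t.1.card = k := by have := t.2; omega
  rw [simplexBoundary_apply, Finset.sum_congr rfl fun s _ => simplexSphere_apply hc s,
    Finset.sum_boole, Finset.filter_filter]
  by_cases htc : t.1 ⊆ c
  · rw [card_cells_between ht hc htc]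
    rfl
  · rw [Finset.filter_false_of_mem fun s _ h => htc (h.1.trans h.2)]
    simp

/-- A cycle that vanishes on all cells avoiding the vertex `0` is zero. -/
theorem eq_zero_of_mem_ker_of_forall_notMem {n k : ℕ} (hk : 1 ≤ k) {z : SimplexChain n k}
    (hz : z ∈ LinearMap.ker (simplexBoundary n k))
    (h : ∀ s : SimplexCell n k, (0 : Fin (n + 1)) ∉ s.1 → z s = 0) : z = 0 := by
  funext s
  by_cases hs : (0 : Fin (n + 1)) ∈ s.1
  · have hb := congrFun (LinearMap.mem_ker.1 hz)
      ⟨s.1.erase 0, by rw [Finset.card_erase_of_mem hs, s.2]; omega⟩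
    rw [simplexBoundary_apply, Finset.sum_eq_single_of_mem s] at hb
    · exact hb
    · simpa using Finset.erase_subset _ _
    · intro u hu hus
      refine h u fun h0 => hus (Subtype.ext ?_)
      have hsub : s.1 ⊆ u.1 := by
        rw [← Finset.insert_erase hs]
        exact Finset.insert_subset h0 (Finset.mem_filter.1 hu).2
      exact (Finset.eq_of_subset_of_card_le hsub (by rw [u.2, s.2])).symm
  · exact h s hs

/-- On cells avoiding the vertex `0`, the spheres through `0` are dual to the indicators. -/
theorem simplexSphere_apply_of_notMem {n k : ℕ} {c : Finset (Fin (n + 1))}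
    (hc : c.card = k + 2) (h0 : (0 : Fin (n + 1)) ∈ c) (s : SimplexCell n k)
    (hs : (0 : Fin (n + 1)) ∉ s.1) :
    simplexSphere n k c s = if c = insert 0 s.1 then 1 else 0 := by
  rw [simplexSphere_apply hc]
  refine if_congr ⟨fun h => ?_, fun h => h ▸ Finset.subset_insert _ _⟩ rfl rfl
  refine (Finset.eq_of_subset_of_card_le (Finset.insert_subset h0 h) ?_).symm
  rw [Finset.card_insert_of_notMem hs, hc, s.2]

/-- The coefficient of a cell avoiding `0` in a combination of the spheres through `0`. -/
theorem sum_smul_simplexSphere_apply {n k : ℕ}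
    (g : {c : Finset (Fin (n + 1)) // c.card = k + 2 ∧ (0 : Fin (n + 1)) ∈ c} → ZMod 2)
    (s : SimplexCell n k) (hs : (0 : Fin (n + 1)) ∉ s.1) :
    (∑ c, g c • simplexSphere n k c.1) s =
      g ⟨insert 0 s.1, by rw [Finset.card_insert_of_notMem hs, s.2],
        Finset.mem_insert_self _ _⟩ := by
  have hc : (insert 0 s.1).card = k + 2 := by rw [Finset.card_insert_of_notMem hs, s.2]
  have h0 : (0 : Fin (n + 1)) ∈ insert 0 s.1 := Finset.mem_insert_self _ _
  rw [Finset.sum_apply, Finset.sum_eq_single ⟨insert 0 s.1, hc, h0⟩]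
  · rw [Pi.smul_apply, simplexSphere_apply_of_notMem hc h0 s hs, if_pos rfl, smul_eq_mul,
      mul_one]
  · intro c _ hcs
    rw [Pi.smul_apply, simplexSphere_apply_of_notMem c.2.1 c.2.2 s hs,
      if_neg fun h => hcs (Subtype.ext h), smul_zero]
  · simp

/-- For `1 ≤ k ≤ n-1`, the simplex sphere family `B'(n,k)` — the chains
`∂c` as `c` ranges over the `(k+2)`-element subsets of `Fin (n+1)` containing the vertex `0` —
is a basis of the `ℤ/2`-cycle space `Z_k` of the `n`-simplex: it is a linearly independent
family whose span is the kernel of `∂ₖ`. -/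
theorem simplex_sphere_family_is_basis (n k : ℕ) (hk : 1 ≤ k) (hkn : k ≤ n - 1) :
    LinearIndependent (ZMod 2)
      (fun c : {c : Finset (Fin (n + 1)) // c.card = k + 2 ∧ (0 : Fin (n + 1)) ∈ c} =>
        simplexSphere n k c.1) ∧
    Submodule.span (ZMod 2)
      (Set.range
        (fun c : {c : Finset (Fin (n + 1)) // c.card = k + 2 ∧ (0 : Fin (n + 1)) ∈ c} =>
          simplexSphere n k c.1)) =
      LinearMap.ker (simplexBoundary n k) := by
  refine ⟨Fintype.linearIndependent_iff.2 fun g hg c => ?_, le_antisymm ?_ fun z hz => ?_⟩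
  · have h := sum_smul_simplexSphere_apply g
      ⟨c.1.erase 0, by rw [Finset.card_erase_of_mem c.2.2, c.2.1]; rfl⟩
      (Finset.notMem_erase _ _)
    rw [hg] at h
    simpa only [Finset.insert_erase c.2.2, Pi.zero_apply] using h.symm
  · rw [Submodule.span_le]
    rintro _ ⟨c, rfl⟩
    exact simplexSphere_mem_ker hk c.2.1
  · let g (c : {c : Finset (Fin (n + 1)) // c.card = k + 2 ∧ (0 : Fin (n + 1)) ∈ c}) : ZMod 2 :=
      z ⟨c.1.erase 0, by rw [Finset.card_erase_of_mem c.2.2, c.2.1]; rfl⟩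
    have hzg : z - ∑ c, g c • simplexSphere n k c.1 = 0 := by
      refine eq_zero_of_mem_ker_of_forall_notMem hk (sub_mem hz (sum_mem fun c _ =>
        Submodule.smul_mem _ _ (simplexSphere_mem_ker hk c.2.1))) fun s hs => ?_
      rw [Pi.sub_apply, sum_smul_simplexSphere_apply g s hs]
      simp only [g, Finset.erase_insert hs, sub_self]
    rw [sub_eq_zero.1 hzg]
    exact sum_mem fun c _ => Submodule.smul_mem _ _ (Submodule.subset_span ⟨c, rfl⟩)
end

section
/- For all integers n, k with 1 ≤ k ≤ n−1, the cube sphere family B(n,k) is a basis of the ℤ/2-cycle space Z_k of the n-cube; that is, the chains ∂_{k+1}(S,f), as (S,f) ranges over the (k+1)-faces of Q_n with f(j) = 0 for every coordinate j ∉ S exceeding max S, form a linearly independent spanning set of the kernel of ∂_k. -/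
open Finset

/-- A `k`-face of the `n`-cube `Qₙ = [0,1]^n`, encoded as a function `Fin n → Option Bool`:
`g j = none` means coordinate `j` is free and `g j = some b` means coordinate `j` is fixed at
the value `b` (`false` for `0`, `true` for `1`).  A `k`-face has exactly `k` free coordinates.
This encodes the pair `(S, f)` with `S = {j | g j = none}` the `k`-element set of free
coordinates and `f : j ∉ S → {0,1}` the fixed values. -/
abbrev CubeCell (n k : ℕ) :=
  {g : Fin n → Option Bool // (univ.filter fun j => g j = none).card = k}

/-- The `ℤ/2`-vector space `Cₖ` of mod-2 `k`-chains of the `n`-cube. -/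
abbrev CubeChain (n k : ℕ) := CubeCell n k → ZMod 2

/-- `(T, g)` is a face of `(S, f)` iff `T ⊆ S` and `g j = f j` for every coordinate `j ∉ S`;
in this encoding: wherever the bigger face is fixed, the smaller face is fixed at the same
value. -/
def IsCubeSubface {n l k : ℕ} (h : CubeCell n l) (g : CubeCell n k) : Prop :=
  ∀ j, g.1 j ≠ none → h.1 j = g.1 j

instance {n l k : ℕ} (h : CubeCell n l) (g : CubeCell n k) : Decidable (IsCubeSubface h g) :=
  inferInstanceAs (Decidable (∀ j, g.1 j ≠ none → h.1 j = g.1 j))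

/-- The mod-2 boundary map `∂ₖ : Cₖ → C_{k-1}`: the indicator of a `k`-face `(S, f)` is sent
to the sum of the indicators of its `2k` facets `(S \ {i}, f_{i↦ε})` for `i ∈ S`, `ε ∈ {0,1}`.
Equivalently (by `ℤ/2`-linearity), the coefficient of a `(k-1)`-face `h` in `∂ₖ x` is the sum
of `x g` over the `k`-faces `g` having `h` as a face (each such `h` arises from a unique
pair `(i, ε)`). -/
def cubeBoundary (n k : ℕ) : CubeChain n k →ₗ[ZMod 2] CubeChain n (k - 1) where
  toFun x h := ∑ g ∈ univ.filter (fun g : CubeCell n k => IsCubeSubface h g), x g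
  map_add' x y := by funext t; exact Finset.sum_add_distrib
  map_smul' c x := by funext t; simp [Finset.mul_sum]

/-- Membership in the cube family `C(n,k)` (stated for a face of any dimension; it is used for
`(k+1)`-faces): `(S, f)` is in the family iff `f j = 0` for every fixed coordinate `j ∉ S`
exceeding `max S`, i.e. exceeding every free coordinate. -/
def InCubeFamily {n k : ℕ} (g : CubeCell n k) : Prop :=
  ∀ j, g.1 j ≠ none → (∀ i, g.1 i = none → i < j) → g.1 j = some false

instance {n k : ℕ} (g : CubeCell n k) : Decidable (InCubeFamily g) :=
  inferInstanceAs
    (Decidable (∀ j, g.1 j ≠ none → (∀ i, g.1 i = none → i < j) → g.1 j = some false))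

/-- `∂_{k+1}(S,f)` for a `(k+1)`-face `(S,f)`: the boundary of the indicator of that
`(k+1)`-cube; it is a `k`-chain (a `k`-dimensional sphere). -/
def cubeSphere (n k : ℕ) (c : CubeCell n (k + 1)) : CubeChain n k :=
  cubeBoundary n (k + 1) (fun g => if g = c then 1 else 0)

theorem card_free_update_none {n : ℕ} {h : Fin n → Option Bool} {j : Fin n} (hj : h j ≠ none) :
    (univ.filter fun a => Function.update h j none a = none).card =
      (univ.filter fun a => h a = none).card + 1 := by
  have : (univ.filter fun a => Function.update h j none a = none) =
      insert j (univ.filter fun a => h a = none) := by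
    ext a
    by_cases ha : a = j <;> simp [ha]
  rw [this, card_insert_of_notMem (by simpa using hj)]

theorem card_free_update_some {n : ℕ} {g : Fin n → Option Bool} {j : Fin n} (b : Bool)
    (hj : g j = none) :
    (univ.filter fun a => Function.update g j (some b) a = none).card + 1 =
      (univ.filter fun a => g a = none).card := by
  have := card_free_update_none (h := Function.update g j (some b)) (j := j) (by simp)
  rw [← this, Function.update_idem, show Function.update g j none = g by
    rw [← hj, Function.update_eq_self]]

/-- Two cells of the same dimension sharing a subface are equal as soon as the free coordinates
of one are free in the other. -/
theorem CubeCell.eq_of_isCubeSubface {n k l : ℕ} {h : CubeCell n l} {g g' : CubeCell n k}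
    (hg : IsCubeSubface h g) (hg' : IsCubeSubface h g')
    (hfree : ∀ j, g.1 j = none → g'.1 j = none) : g = g' := by
  have hsub : (univ.filter fun j => g.1 j = none) ⊆ univ.filter fun j => g'.1 j = none := by
    intro j
    simpa using hfree j
  have heq := eq_of_subset_of_card_le hsub (by rw [g.2, g'.2])
  ext1
  funext j
  have hiff : g.1 j = none ↔ g'.1 j = none := by simpa using Finset.ext_iff.1 heq j
  by_cases hj : g.1 j = none
  · rw [hj, hiff.1 hj]
  · rw [← hg j hj, ← hg' j (mt hiff.2 hj)]

theorem IsCubeSubface.eq_none {n k l : ℕ} {h : CubeCell n l} {g : CubeCell n k}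
    (hg : IsCubeSubface h g) {j : Fin n} (hj : h.1 j = none) : g.1 j = none := by
  by_contra hne
  exact hne ((hg j hne).symm.trans hj)

theorem CubeCell.exists_last_free {n k : ℕ} (g : CubeCell n (k + 1)) :
    ∃ i, g.1 i = none ∧ ∀ j, i < j → g.1 j ≠ none := by
  have hne : (univ.filter fun j => g.1 j = none).Nonempty := by
    rw [← card_pos, g.2]
    omega
  obtain ⟨i, hi, hmax⟩ := exists_max_image _ id hne
  refine ⟨i, by simpa using hi, fun j hj hjn => ?_⟩
  exact absurd (hmax j (by simpa using hjn)) (not_le.2 hj)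

/-- A cycle of positive dimension supported on the cube family vanishes. -/
theorem eq_zero_of_mem_ker_cubeBoundary {n k : ℕ} {z : CubeChain n (k + 1)}
    (hz : z ∈ LinearMap.ker (cubeBoundary n (k + 1)))
    (hfam : ∀ g, ¬ InCubeFamily g → z g = 0) : z = 0 := by
  have key : ∀ i : Fin n, ∀ g : CubeCell n (k + 1), g.1 i = none →
      (∀ j, i < j → g.1 j ≠ none) → z g = 0 := by
    intro i
    induction i using WellFoundedGT.induction with
    | ind i ih =>
      intro g hgi hlast
      by_cases hgf : InCubeFamily g
      swap
      · exact hfam g hgf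
      let h : CubeCell n k := ⟨Function.update g.1 i (some true), by
        have := card_free_update_some true hgi
        have := g.2
        omega⟩
      have hhg : IsCubeSubface h g := by
        intro j hj
        have hji : j ≠ i := fun e => hj (e ▸ hgi)
        simp [h, hji]
      have hzh : ∑ g' ∈ univ.filter (fun g' : CubeCell n (k + 1) => IsCubeSubface h g'), z g' = 0 :=
        congrFun (LinearMap.mem_ker.1 hz) h
      rwa [sum_eq_single_of_mem g (by simpa using hhg)] at hzh
      intro g' hg' hne
      have hhg' : IsCubeSubface h g' := by simpa using hg'
      by_cases hgf' : InCubeFamily g'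
      swap
      · exact hfam g' hgf'
      obtain ⟨i', hi', hlast'⟩ := g'.exists_last_free
      rcases lt_or_ge i i' with hlt | hle
      · exact ih i' hlt g' hi' hlast'
      · refine absurd (CubeCell.eq_of_isCubeSubface hhg hhg' fun j hj => ?_) hne.symm
        by_cases hji : j = i
        · subst hji
          by_contra hg'j
          have h1 : g'.1 j = some false := hgf' j hg'j fun a ha => by
            rcases lt_trichotomy a j with hlt | rfl | hlt
            · exact hlt
            · exact absurd ha hg'j
            · exact absurd ha (hlast' a (hle.trans_lt hlt))
          have h2 := hhg' j hg'j
          simp [h, h1] at h2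
        · exact hhg'.eq_none (by simp [h, hji, hj])
  funext g
  obtain ⟨i, hi, hlast⟩ := g.exists_last_free
  exact key i g hi hlast

theorem card_between_eq_two {n k : ℕ} {h : CubeCell n k} {g : CubeCell n (k + 2)}
    (hhg : IsCubeSubface h g) :
    (univ.filter fun f : CubeCell n (k + 1) => IsCubeSubface h f ∧ IsCubeSubface f g).card = 2 := by
  have hsub : (univ.filter fun j => h.1 j = none) ⊆ univ.filter fun j => g.1 j = none := by
    intro j
    simpa using hhg.eq_none
  have hcard :
      ((univ.filter fun j => g.1 j = none) \ univ.filter fun j => h.1 j = none).card = 2 := by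
    rw [card_sdiff_of_subset hsub, g.2, h.2]
    omega
  refine Eq.trans (Eq.symm ?_) hcard
  refine card_bij (fun j hj => ⟨Function.update h.1 j none, by
      rw [card_free_update_none (by simpa using (mem_sdiff.1 hj).2), h.2]⟩) ?_ ?_ ?_
  · intro j hj
    simp only [mem_sdiff, mem_filter, mem_univ, true_and] at hj ⊢
    refine ⟨fun a ha => ?_, fun a ha => ?_⟩
    · have : a ≠ j := by rintro rfl; simp at ha
      simp [this]
    · have : a ≠ j := by rintro rfl; exact ha hj.1
      simpa [this] using hhg a ha
  · intro a ha b hb hab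
    simp only [mem_sdiff, mem_filter, mem_univ, true_and] at ha hb
    by_contra hne
    have := congrFun (congrArg Subtype.val hab) a
    simp [hne] at this
    exact ha.2 this.symm
  · intro f hf
    simp only [mem_filter, mem_univ, true_and] at hf
    obtain ⟨j, hfj, hhj⟩ : ∃ j, f.1 j = none ∧ h.1 j ≠ none := by
      by_contra! hcon
      have : (univ.filter fun j => f.1 j = none).card ≤ (univ.filter fun j => h.1 j = none).card :=
        card_le_card fun j => by simpa using hcon j
      rw [f.2, h.2] at this
      omega
    refine ⟨j, by simpa using ⟨hf.2.eq_none hfj, hhj⟩, ?_⟩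
    refine CubeCell.eq_of_isCubeSubface (h := h) (fun a ha => ?_) hf.1 fun a ha => ?_
    · have : a ≠ j := by rintro rfl; simp at ha
      simp [this]
    · by_cases haj : a = j
      · rw [haj, hfj]
      · exact hf.1.eq_none (by simpa [haj] using ha)

theorem cubeBoundary_cubeBoundary {n k : ℕ} (x : CubeChain n (k + 2)) :
    cubeBoundary n (k + 1) (cubeBoundary n (k + 2) x) = 0 := by
  funext h
  change ∑ f ∈ univ.filter (fun f : CubeCell n (k + 1) => IsCubeSubface (k := k + 1) (l := k) h f),
    ∑ g ∈ univ.filter (fun g : CubeCell n (k + 2) => IsCubeSubface f g), x g = 0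
  simp_rw [sum_filter]
  simp_rw [← sum_filter (fun f : CubeCell n (k + 1) => IsCubeSubface (k := k + 1) (l := k) h f)]
  rw [sum_comm]
  refine sum_eq_zero fun g _ => ?_
  rw [← sum_filter, filter_filter, sum_const]
  by_cases hhg : IsCubeSubface (l := k) h g
  · rw [card_between_eq_two hhg, nsmul_eq_mul]
    exact mul_eq_zero_of_left (by decide) _
  · rw [filter_false_of_mem, card_empty, zero_smul]
    rintro f - ⟨hhf, hfg⟩
    exact hhg fun j hj => (hhf j (by rwa [hfg j hj])).trans (hfg j hj)

theorem exists_last_true_of_not_inCubeFamily {n k : ℕ} {h : CubeCell n k} (hh : ¬ InCubeFamily h) :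
    ∃ j, h.1 j = some true ∧ ∀ a, j < a → h.1 a = some false := by
  have hne : (univ.filter fun a => h.1 a ≠ some false).Nonempty := by
    by_contra hem
    refine hh fun j _ _ => ?_
    by_contra hj
    exact hem ⟨j, by simpa using hj⟩
  obtain ⟨j, hj, hmax⟩ := exists_max_image _ id hne
  have hlast : ∀ a, j < a → h.1 a = some false := fun a ha => by
    by_contra hcon
    exact absurd (hmax a (by simpa using hcon)) (not_le.2 ha)
  refine ⟨j, ?_, hlast⟩
  unfold InCubeFamily at hh
  push Not at hh
  obtain ⟨a, ha, hfree, hfalse⟩ := hh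
  have haj : a ≤ j := not_lt.1 fun hlt => hfalse (hlast a hlt)
  have hjn : h.1 j ≠ none := fun e => absurd (hfree j e) (not_lt.2 haj)
  have hjf : h.1 j ≠ some false := by simpa using hj
  rcases hv : h.1 j with _ | _ | _ <;> simp_all

theorem card_not_inCubeFamily_le (n k : ℕ) :
    Fintype.card {h : CubeCell n k // ¬ InCubeFamily h} ≤
      Fintype.card {g : CubeCell n (k + 1) // InCubeFamily g} := by
  choose p hp hlast using fun h : {h : CubeCell n k // ¬ InCubeFamily h} =>
    exists_last_true_of_not_inCubeFamily h.2
  refine Fintype.card_le_of_injective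
    (fun h => ⟨⟨Function.update h.1.1 (p h) none, by
      rw [card_free_update_none (by simp [hp]), h.1.2]⟩, fun j _ hj => ?_⟩) ?_
  · have hlt : p h < j := hj (p h) (by simp)
    simpa [hlt.ne'] using hlast h j hlt
  · intro h h' heq
    have heq' : Function.update h.1.1 (p h) none = Function.update h'.1.1 (p h') none :=
      congrArg (fun g => g.1.1) heq
    have hpp : p h = p h' := by
      rcases lt_trichotomy (p h) (p h') with hlt | he | hlt
      · have := congrFun heq' (p h')
        simp [hlt.ne', hlast h _ hlt] at this
      · exact he
      · have := congrFun heq' (p h)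
        simp [hlt.ne', hlast h' _ hlt] at this
    ext1
    ext1
    funext j
    by_cases hj : j = p h
    · rw [hj, hp, hpp, hp]
    · simpa [hj, hpp ▸ hj] using congrFun heq' j

theorem cubeSphere_eq (n k : ℕ) (c : CubeCell n (k + 1)) :
    cubeSphere n k c = cubeBoundary n (k + 1) (Pi.single c 1) := by
  unfold cubeSphere
  congr 1
  funext g
  rw [Pi.single_apply]

theorem linearIndependent_cubeSphere (n k : ℕ) :
    LinearIndependent (ZMod 2)
      (fun c : {g : CubeCell n (k + 1) // InCubeFamily g} => cubeSphere n k c.1) := by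
  simp_rw [cubeSphere_eq]
  have hsingle : LinearIndependent (ZMod 2)
      (fun c : {g : CubeCell n (k + 1) // InCubeFamily g} =>
        (Pi.single c.1 1 : CubeChain n (k + 1))) :=
    (Pi.linearIndependent_single_one (CubeCell n (k + 1)) (ZMod 2)).comp _ Subtype.val_injective
  refine hsingle.map (f := cubeBoundary n (k + 1)) (Submodule.disjoint_def.2 fun x hx hker => ?_)
  refine eq_zero_of_mem_ker_cubeBoundary hker fun g hg => ?_
  have hle : Submodule.span (ZMod 2) (Set.range
      (fun c : {g : CubeCell n (k + 1) // InCubeFamily g} =>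
        (Pi.single c.1 1 : CubeChain n (k + 1)))) ≤
      LinearMap.ker (LinearMap.proj g : CubeChain n (k + 1) →ₗ[ZMod 2] ZMod 2) := by
    rw [Submodule.span_le]
    rintro _ ⟨c, rfl⟩
    have : g ≠ c.1 := fun e => hg (e ▸ c.2)
    simp [this]
  simpa using hle hx

theorem finrank_ker_cubeBoundary_le (n k : ℕ) :
    Module.finrank (ZMod 2) (LinearMap.ker (cubeBoundary n (k + 1))) ≤
      Fintype.card {h : CubeCell n (k + 1) // ¬ InCubeFamily h} := by
  rw [← Module.finrank_fintype_fun_eq_card (ZMod 2)]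
  refine LinearMap.finrank_le_finrank_of_injective
    (f := (LinearMap.funLeft (ZMod 2) (ZMod 2) Subtype.val).comp (Submodule.subtype _)) ?_
  rw [← LinearMap.ker_eq_bot, LinearMap.ker_eq_bot']
  intro z hz
  exact Subtype.ext (eq_zero_of_mem_ker_cubeBoundary z.2 fun g hg => congrFun hz ⟨g, hg⟩)

/-- For `1 ≤ k ≤ n-1`, the cube sphere family `B(n,k)` — the chains
`∂_{k+1}(S,f)` as `(S,f)` ranges over the `(k+1)`-faces of `Qₙ` with `f j = 0` for every
coordinate `j ∉ S` exceeding `max S` — is a basis of the `ℤ/2`-cycle space `Z_k` of the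
`n`-cube: it is a linearly independent family whose span is the kernel of `∂ₖ`. -/
theorem cube_sphere_family_is_basis (n k : ℕ) (hk : 1 ≤ k) (hkn : k ≤ n - 1) :
    LinearIndependent (ZMod 2)
      (fun c : {g : CubeCell n (k + 1) // InCubeFamily g} => cubeSphere n k c.1) ∧
    Submodule.span (ZMod 2)
      (Set.range (fun c : {g : CubeCell n (k + 1) // InCubeFamily g} => cubeSphere n k c.1)) =
      LinearMap.ker (cubeBoundary n k) := by
  refine ⟨linearIndependent_cubeSphere n k, ?_⟩
  obtain ⟨k, rfl⟩ := Nat.exists_eq_add_of_le' hk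
  refine Submodule.eq_of_le_of_finrank_le ?_ ?_
  · rw [Submodule.span_le]
    rintro _ ⟨c, rfl⟩
    exact cubeBoundary_cubeBoundary _
  · rw [finrank_span_eq_card (linearIndependent_cubeSphere n (k + 1))]
    exact (finrank_ker_cubeBoundary_le n k).trans (card_not_inCubeFamily_le n (k + 1))
end

section
/- For all integers n, k with 1 ≤ k ≤ n−1, every k-face of the n-cube Q_n is a face of some member of the cube family C(n,k): for every k-face (T, g) there exists a (k+1)-face (S, f) ∈ C(n,k) with T ⊆ S and with g agreeing with f on every coordinate outside S. -/
open Finset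

/-- Replacing a fixed coordinate of a `k`-face by a free one gives a `(k+1)`-face. -/
theorem CubeCell.card_free_update {n k : ℕ} (h : CubeCell n k) {p : Fin n} (hp : h.1 p ≠ none) :
    (univ.filter fun j => Function.update h.1 p none j = none).card = k + 1 := by
  have hset : (univ.filter fun j => Function.update h.1 p none j = none) =
      insert p (univ.filter fun j => h.1 j = none) := by
    ext j
    by_cases hj : j = p <;> simp [Function.update_apply, hj]
  rw [hset, card_insert_of_notMem (by simp [hp]), h.2]

/-- A face of dimension less than `n` has a fixed coordinate after which no coordinate is fixed
at `1`. -/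
theorem CubeCell.exists_fixed_forall_lt_ne_true {n k : ℕ} (h : CubeCell n k) (hkn : k < n) :
    ∃ p, h.1 p ≠ none ∧ ∀ j, p < j → h.1 j ≠ some true := by
  by_cases hne : (univ.filter fun j => h.1 j = some true).Nonempty
  · obtain ⟨p, hp, hmax⟩ := exists_max_image _ id hne
    simp only [mem_filter, mem_univ, true_and, id] at hp hmax
    exact ⟨p, by simp [hp], fun j hj hj' => (hmax j hj').not_gt hj⟩
  · simp only [not_nonempty_iff_eq_empty, filter_eq_empty_iff, mem_univ, true_imp_iff] at hne
    have hfix : ∃ p, h.1 p ≠ none := by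
      by_contra! hall
      have hcard := h.2
      simp only [hall, filter_true, card_univ, Fintype.card_fin] at hcard
      omega
    obtain ⟨p, hp⟩ := hfix
    exact ⟨p, hp, fun _ _ => @hne _⟩

/-- For `1 ≤ k ≤ n-1`, every `k`-face of the `n`-cube is a face of some
member of the cube family `C(n,k)`: for every `k`-face `(T,g)` there is a `(k+1)`-face
`(S,f) ∈ C(n,k)` with `T ⊆ S` and `g` agreeing with `f` on every coordinate outside `S`. -/
theorem every_cube_face_in_some_family_member (n k : ℕ) (hk : 1 ≤ k) (hkn : k ≤ n - 1) :
    ∀ h : CubeCell n k, ∃ g : CubeCell n (k + 1), InCubeFamily g ∧ IsCubeSubface h g := by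
  intro h
  obtain ⟨p, hp, hlast⟩ := h.exists_fixed_forall_lt_ne_true (by omega)
  refine ⟨⟨Function.update h.1 p none, h.card_free_update hp⟩, fun j hj hmax => ?_, fun j hj => ?_⟩
  · have hpj : p < j := hmax p (by simp)
    have hjt := hlast j hpj
    simp only [Function.update_of_ne hpj.ne'] at hj ⊢
    cases hv : h.1 j with
    | none => exact absurd hv hj
    | some b => cases b <;> simp_all
  · have hjp : j ≠ p := by
      rintro rfl
      simp at hj
    simp [Function.update_of_ne hjp]
end

section
/- For all integers n, k with 1 ≤ k ≤ n−1, the family of chains ∂_{k+1}(S,f), indexed by the (k+1)-faces (S,f) in the cube family C(n,k), is linearly independent over ℤ/2. -/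
open Finset

theorem cubeSphere_apply {n k : ℕ} (c : CubeCell n (k + 1)) (h : CubeCell n k) :
    cubeSphere n k c h = if IsCubeSubface h c then 1 else 0 := by
  change (∑ g ∈ univ.filter (fun g : CubeCell n (k + 1) => IsCubeSubface h g),
    (if g = c then (1 : ZMod 2) else 0)) = _
  simp [Finset.sum_ite_eq']

/-- A cell with a subface of its own dimension equals that subface. -/
theorem IsCubeSubface.eq {n k : ℕ} {c d : CubeCell n k} (h : IsCubeSubface c d) : d = c := by
  have hsub : (univ.filter fun j => c.1 j = none) ⊆ univ.filter fun j => d.1 j = none := by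
    intro j hj
    simp only [mem_filter, mem_univ, true_and] at hj ⊢
    by_contra hd
    exact hd ((h j hd).symm.trans hj)
  have heq := eq_of_subset_of_card_le hsub (by rw [c.2, d.2])
  ext1
  funext j
  by_cases hd : d.1 j = none
  · have hj : j ∈ univ.filter fun j => c.1 j = none := by rw [heq]; simpa using hd
    rw [hd, (mem_filter.1 hj).2]
  · exact (h j hd).symm

theorem CubeCell.exists_isGreatest_free {n k : ℕ} (c : CubeCell n (k + 1)) :
    ∃ m, IsGreatest {j | c.1 j = none} m := by
  have hne : (univ.filter fun j => c.1 j = none).Nonempty := by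
    rw [← card_pos, c.2]; exact k.succ_pos
  exact ⟨_, by simpa using isGreatest_max' _ hne⟩

/-- The facet of `c` on which the free coordinate `m` takes the value `1`. -/
def CubeCell.upperFacet {n k : ℕ} (c : CubeCell n (k + 1)) (m : Fin n) (hm : c.1 m = none) :
    CubeCell n k :=
  ⟨Function.update c.1 m (some true), by
    have : (univ.filter fun j => Function.update c.1 m (some true) j = none) =
        (univ.filter fun j => c.1 j = none).erase m := by
      ext j
      by_cases hj : j = m
      · subst hj; simp
      · simp [hj]
    rw [this, card_erase_of_mem (by simpa using hm), c.2, Nat.add_sub_cancel]⟩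

theorem CubeCell.isCubeSubface_upperFacet {n k : ℕ} (c : CubeCell n (k + 1)) (m : Fin n)
    (hm : c.1 m = none) : IsCubeSubface (c.upperFacet m hm) c := by
  intro j hj
  exact Function.update_of_ne (by rintro rfl; exact hj hm) _ _

/-- Any other cell of the family containing the upper facet of `c` in its last free direction
has a later last free direction. -/
theorem InCubeFamily.lt_of_isCubeSubface_upperFacet {n k : ℕ} {c d : CubeCell n (k + 1)}
    {m m' : Fin n} (hd : InCubeFamily d) (hm : c.1 m = none)
    (hm' : IsGreatest {j | d.1 j = none} m') (hsub : IsCubeSubface (c.upperFacet m hm) d)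
    (hne : d ≠ c) : m < m' := by
  by_contra! hle
  have hdm : d.1 m = none := by
    by_contra hfix
    have htrue : some true = d.1 m := by
      simpa [CubeCell.upperFacet] using hsub m hfix
    have hlt : m' < m := lt_of_le_of_ne hle (by rintro rfl; exact hfix hm'.1)
    have hfalse := hd m hfix fun i hi => (hm'.2 hi).trans_lt hlt
    simp [hfalse] at htrue
  refine hne (IsCubeSubface.eq fun j hj => ?_)
  rw [← hsub j hj]
  exact (Function.update_of_ne (by rintro rfl; exact hj hdm) _ _).symm

/-- For `1 ≤ k ≤ n-1`, the chains `∂_{k+1}(S,f)`, indexed by the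
`(k+1)`-faces `(S,f)` in the cube family `C(n,k)`, are linearly independent over `ℤ/2`. -/
theorem cube_sphere_family_linearIndependent (n k : ℕ) (hk : 1 ≤ k) (hkn : k ≤ n - 1) :
    LinearIndependent (ZMod 2)
      (fun c : {g : CubeCell n (k + 1) // InCubeFamily g} => cubeSphere n k c.1) := by
  rw [Fintype.linearIndependent_iff]
  intro x hx
  have key : ∀ (m : Fin n) (c : {g : CubeCell n (k + 1) // InCubeFamily g}),
      IsGreatest {j | c.1.1 j = none} m → x c = 0 := by
    intro m
    induction m using WellFoundedGT.induction with
    | ind m ih =>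
      intro c hc
      have hsum := congrFun hx (c.1.upperFacet m hc.1)
      simp only [Finset.sum_apply, Pi.smul_apply, cubeSphere_apply, Pi.zero_apply,
        smul_eq_mul] at hsum
      rw [Finset.sum_eq_single c] at hsum
      · simpa [c.1.isCubeSubface_upperFacet m hc.1] using hsum
      · intro d _ hdc
        split_ifs with hsub
        · obtain ⟨m', hm'⟩ := d.1.exists_isGreatest_free
          rw [ih m' (d.2.lt_of_isCubeSubface_upperFacet hc.1 hm' hsub
            fun h => hdc (Subtype.ext h)) d hm', zero_mul]
        · exact mul_zero _
      · exact fun h => absurd (mem_univ c) h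
  intro c
  obtain ⟨m, hm⟩ := c.1.exists_isGreatest_free
  exact key m c hm
end

section
/- For all integers n, k with 1 ≤ k ≤ n−1, the cardinality of the cube family C(n,k) equals s(n,k) := Σ_{j=k}^{n−1} binomial(j, k) · 2^{j−k}. -/
open Finset

/-- Counting tuples of length `n + 1` by their last entry. -/
theorem card_filter_snoc {α : Type*} [Fintype α] [DecidableEq α] (n : ℕ)
    (P : (Fin (n + 1) → α) → Prop) [DecidablePred P] :
    (univ.filter P).card =
      ∑ a : α, (univ.filter fun g : Fin n → α => P (Fin.snoc g a)).card := by
  simp only [Finset.card_filter]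
  rw [← Fintype.sum_prod_type' fun (a : α) (g : Fin n → α) => if P (Fin.snoc g a) then 1 else 0]
  exact (Equiv.sum_comp (Fin.snocEquiv fun _ => α) fun g => if P g then 1 else 0).symm

theorem card_free_snoc {n : ℕ} (g : Fin n → Option Bool) (a : Option Bool) :
    (univ.filter fun j => (Fin.snoc g a : Fin (n + 1) → Option Bool) j = none).card =
      (univ.filter fun j => g j = none).card + if a = none then 1 else 0 := by
  simp only [Finset.card_filter, Fin.sum_univ_castSucc, Fin.snoc_castSucc, Fin.snoc_last]

/-- The number of `k`-faces of the `n`-cube. -/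
theorem card_cubeCell (n k : ℕ) :
    (univ.filter fun g : Fin n → Option Bool =>
      (univ.filter fun j => g j = none).card = k).card = n.choose k * 2 ^ (n - k) := by
  induction n generalizing k with
  | zero => cases k <;> simp
  | succ n ih =>
    rw [card_filter_snoc]
    simp only [card_free_snoc, Fintype.sum_option, Fintype.sum_bool]
    cases k with
    | zero =>
      simp only [reduceCtorEq, if_true, if_false, add_zero, Nat.add_eq_zero_iff, one_ne_zero,
        and_false, Finset.filter_false, Finset.card_empty, ih, Nat.choose_zero_right, Nat.sub_zero]
      ring
    | succ k =>
      simp only [reduceCtorEq, if_true, if_false, add_zero, Nat.add_right_cancel_iff, ih,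
        Nat.choose_succ_succ, Nat.add_sub_add_right]
      rcases lt_or_ge n (k + 1) with h | h
      · simp [Nat.choose_eq_zero_of_lt h]
      · obtain ⟨m, rfl⟩ := Nat.exists_eq_add_of_le h
        rw [show k + 1 + m - k = m + 1 by omega, show k + 1 + m - (k + 1) = m by omega]
        ring

theorem card_cubeFamily_eq_sum_range (n k : ℕ) :
    (univ.filter fun g : Fin n → Option Bool =>
      (univ.filter fun j => g j = none).card = k + 1 ∧
        ∀ j, g j ≠ none → (∀ i, g i = none → i < j) → g j = some false).card =
      ∑ j ∈ Finset.range n, j.choose k * 2 ^ (j - k) := by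
  induction n with
  | zero => simp
  | succ n ih =>
    rw [card_filter_snoc, Finset.sum_range_succ, ← ih, ← card_cubeCell n k,
      add_comm (Finset.card _)]
    simp [card_free_snoc, Fintype.sum_option, Fin.forall_fin_succ',
      Fin.castSucc_lt_last, Fin.not_lt.2 (Fin.le_last _)]

/-- For `1 ≤ k ≤ n-1`, the cardinality of the cube family `C(n,k)` equals
`s(n,k) = Σ_{j=k}^{n-1} binomial (j,k) · 2^{j-k}`. -/
theorem cube_family_card (n k : ℕ) (hk : 1 ≤ k) (hkn : k ≤ n - 1) :
    Fintype.card {g : CubeCell n (k + 1) // InCubeFamily g} =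
      ∑ j ∈ Finset.Ico k n, j.choose k * 2 ^ (j - k) := by
  have hsum : ∑ j ∈ Finset.Ico k n, j.choose k * 2 ^ (j - k) =
      ∑ j ∈ Finset.range n, j.choose k * 2 ^ (j - k) := by
    refine Finset.sum_subset (fun j hj => by simp at hj ⊢; omega) fun j hj hj' => ?_
    rw [Nat.choose_eq_zero_of_lt (by simp at hj hj'; omega), zero_mul]
  rw [hsum, ← card_cubeFamily_eq_sum_range, ← Fintype.card_subtype]
  exact Fintype.card_congr (Equiv.subtypeSubtypeEquivSubtypeInter
    (fun g : Fin n → Option Bool => (univ.filter fun j => g j = none).card = k + 1)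
    fun g => ∀ j, g j ≠ none → (∀ i, g i = none → i < j) → g j = some false)
end

section
/- For all integers n, k with 1 ≤ k ≤ n−1, the ℤ/2-dimension of the cycle space Z_k of the n-cube (the kernel of the boundary map ∂_k on mod-2 k-chains) equals s(n,k) := Σ_{j=k}^{n−1} binomial(j, k) · 2^{j−k}. -/
open Finset

/-- The number of free coordinates of a face of the `n`-cube. -/
def freeCard {n : ℕ} (g : Fin n → Option Bool) : ℕ :=
  (univ.filter fun j => g j = none).card

theorem freeCard_cons {n : ℕ} (o : Option Bool) (g : Fin n → Option Bool) :
    freeCard (Fin.cons o g : Fin (n + 1) → Option Bool) =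
      (if o = none then 1 else 0) + freeCard g := by
  simp only [freeCard, card_filter, Fin.sum_univ_succ, Fin.cons_zero, Fin.cons_succ]

theorem freeCard_update_none {n : ℕ} (h : Fin n → Option Bool) (i : Fin n) (hi : h i ≠ none) :
    freeCard (Function.update h i none) = freeCard h + 1 := by
  have : (univ.filter fun j => Function.update h i none j = none) =
      insert i (univ.filter fun j => h j = none) := by
    ext j
    by_cases hj : j = i
    · subst hj; simp
    · simp [hj]
  rw [freeCard, this, card_insert_of_notMem (by simpa using hi), freeCard]

/-- The boundary map on chains of the `n`-cube of mixed dimension. -/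
def totalBoundary (n : ℕ) :
    ((Fin n → Option Bool) → ZMod 2) →ₗ[ZMod 2] ((Fin n → Option Bool) → ZMod 2) where
  toFun x h := ∑ i, if h i = none then 0 else x (Function.update h i none)
  map_add' x y := by
    funext h
    simp only [Pi.add_apply, ← sum_add_distrib]
    exact sum_congr rfl fun i _ => by split_ifs <;> simp
  map_smul' c x := by
    funext h
    simp [mul_sum]

theorem totalBoundary_apply {n : ℕ} (x : (Fin n → Option Bool) → ZMod 2)
    (h : Fin n → Option Bool) :
    totalBoundary n x h = ∑ i, if h i = none then 0 else x (Function.update h i none) := rfl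

/-- Restriction of a chain of the `(n+1)`-cube to the faces with prescribed first coordinate. -/
def slice (n : ℕ) (o : Option Bool) :
    ((Fin (n + 1) → Option Bool) → ZMod 2) →ₗ[ZMod 2] ((Fin n → Option Bool) → ZMod 2) :=
  LinearMap.funLeft (ZMod 2) (ZMod 2) fun g => Fin.cons o g

theorem slice_apply {n : ℕ} (o : Option Bool) (x : (Fin (n + 1) → Option Bool) → ZMod 2)
    (g : Fin n → Option Bool) : slice n o x g = x (Fin.cons o g) := rfl

theorem slice_ext {n : ℕ} {x y : (Fin (n + 1) → Option Bool) → ZMod 2}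
    (h : ∀ o, slice n o x = slice n o y) : x = y := by
  funext g
  rw [← Fin.cons_self_tail g]
  exact congrFun (h (g 0)) (Fin.tail g)

theorem slice_none_totalBoundary {n : ℕ} (x : (Fin (n + 1) → Option Bool) → ZMod 2) :
    slice n none (totalBoundary (n + 1) x) = totalBoundary n (slice n none x) := by
  funext g
  simp [slice_apply, totalBoundary_apply, Fin.sum_univ_succ, Fin.cons_update]

theorem slice_some_totalBoundary {n : ℕ} (b : Bool) (x : (Fin (n + 1) → Option Bool) → ZMod 2) :
    slice n (some b) (totalBoundary (n + 1) x) =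
      slice n none x + totalBoundary n (slice n (some b) x) := by
  funext g
  simp [slice_apply, totalBoundary_apply, Fin.sum_univ_succ, Fin.cons_update]

theorem totalBoundary_totalBoundary {n : ℕ} (x : (Fin n → Option Bool) → ZMod 2) :
    totalBoundary n (totalBoundary n x) = 0 := by
  induction n with
  | zero => funext g; simp [totalBoundary_apply]
  | succ n ih =>
    refine slice_ext fun o => ?_
    cases o with
    | none => rw [slice_none_totalBoundary, slice_none_totalBoundary, ih, map_zero]
    | some b =>
      rw [slice_some_totalBoundary, slice_none_totalBoundary, slice_some_totalBoundary, map_add,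
        ih, add_zero, CharTwo.add_self_eq_zero, map_zero]

theorem totalBoundary_eq_zero_iff {n : ℕ} (x : (Fin (n + 1) → Option Bool) → ZMod 2) :
    totalBoundary (n + 1) x = 0 ↔ ∀ b, totalBoundary n (slice n (some b) x) = slice n none x := by
  constructor
  · intro h b
    have := slice_some_totalBoundary b x
    rw [h, map_zero] at this
    exact (CharTwo.add_eq_zero.mp this.symm).symm
  · intro h
    refine slice_ext fun o => ?_
    cases o with
    | none => rw [slice_none_totalBoundary, ← h false, totalBoundary_totalBoundary, map_zero]
    | some b => rw [slice_some_totalBoundary, h b, CharTwo.add_self_eq_zero, map_zero]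

/-- The mixed chains of the `n`-cube that are supported on `k`-faces. -/
def homogeneousChains (n k : ℕ) : Submodule (ZMod 2) ((Fin n → Option Bool) → ZMod 2) where
  carrier := {x | ∀ g, freeCard g ≠ k → x g = 0}
  add_mem' hx hy g hg := by simp [hx g hg, hy g hg]
  zero_mem' _ _ := rfl
  smul_mem' c x hx g hg := by simp [hx g hg]

theorem slice_some_mem {n k : ℕ} (b : Bool) {x : (Fin (n + 1) → Option Bool) → ZMod 2}
    (hx : x ∈ homogeneousChains (n + 1) k) : slice n (some b) x ∈ homogeneousChains n k :=
  fun g hg => hx _ (by simpa [freeCard_cons] using hg)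

theorem totalBoundary_mem {n k : ℕ} {x : (Fin n → Option Bool) → ZMod 2}
    (hx : x ∈ homogeneousChains n (k + 1)) : totalBoundary n x ∈ homogeneousChains n k := by
  intro g hg
  rw [totalBoundary_apply]
  refine sum_eq_zero fun i _ => ?_
  split_ifs with hi
  · rfl
  · exact hx _ (by rw [freeCard_update_none g i hi]; omega)

/-- Extension of a `k`-chain by zero to a mixed chain. -/
noncomputable def chainExtend (n k : ℕ) :
    CubeChain n k →ₗ[ZMod 2] ((Fin n → Option Bool) → ZMod 2) :=
  Function.ExtendByZero.linearMap (ZMod 2) Subtype.val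

theorem chainExtend_apply {n k : ℕ} (x : CubeChain n k) (g : CubeCell n k) :
    chainExtend n k x g.1 = x g :=
  Subtype.val_injective.extend_apply x 0 g

theorem chainExtend_mem {n k : ℕ} (x : CubeChain n k) :
    chainExtend n k x ∈ homogeneousChains n k := by
  intro g hg
  exact Function.extend_apply' (f := Subtype.val) x 0 g fun ⟨a, ha⟩ => hg (ha ▸ a.2)

theorem chainExtend_injective (n k : ℕ) : Function.Injective (chainExtend n k) := by
  intro x y h
  funext g
  rw [← chainExtend_apply x, h, chainExtend_apply]

theorem range_chainExtend (n k : ℕ) :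
    LinearMap.range (chainExtend n k) = homogeneousChains n k := by
  ext x
  constructor
  · rintro ⟨y, rfl⟩
    exact chainExtend_mem y
  · intro hx
    refine ⟨fun g => x g.1, funext fun g => ?_⟩
    by_cases hg : freeCard g = k
    · exact chainExtend_apply _ (⟨g, hg⟩ : CubeCell n k)
    · rw [hx g hg, chainExtend_mem _ g hg]

theorem exists_update_of_isCubeSubface {n k : ℕ} (h : CubeCell n k) (g : CubeCell n (k + 1))
    (hg : IsCubeSubface h g) : ∃ i, h.1 i ≠ none ∧ Function.update h.1 i none = g.1 := by
  have hsub : (univ.filter fun j => h.1 j = none) ⊆ univ.filter fun j => g.1 j = none := by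
    intro j
    simp only [mem_filter, mem_univ, true_and]
    intro hj
    by_contra hne
    exact hne (hg j hne ▸ hj)
  have hcard := card_sdiff_add_card_eq_card hsub
  rw [h.2, g.2, add_comm, add_right_inj, card_eq_one] at hcard
  obtain ⟨i, hi⟩ := hcard
  have key : ∀ j, (g.1 j = none ∧ h.1 j ≠ none) ↔ j = i := fun j => by
    simpa using Finset.ext_iff.mp hi j
  obtain ⟨hgi, hhi⟩ := (key i).mpr rfl
  refine ⟨i, hhi, funext fun j => ?_⟩
  by_cases hj : j = i
  · subst hj; simp [hgi]
  · rw [Function.update_of_ne hj]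
    by_cases hgj : g.1 j = none
    · rw [hgj]
      by_contra hne
      exact hj ((key j).mp ⟨hgj, hne⟩)
    · exact hg j hgj

theorem totalBoundary_chainExtend {n k : ℕ} (x : CubeChain n (k + 1)) :
    totalBoundary n (chainExtend n (k + 1) x) =
      chainExtend n k (cubeBoundary n (k + 1) x) := by
  funext h
  by_cases hh : freeCard h = k
  swap
  · rw [totalBoundary_mem (chainExtend_mem x) h hh, chainExtend_mem _ h hh]
  rw [chainExtend_apply _ (⟨h, hh⟩ : CubeCell n k), totalBoundary_apply]
  simp_rw [← ite_not (h _ = none)]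
  rw [← sum_filter]
  refine sum_bij (fun i hi => ⟨Function.update h i none, ?_⟩) ?_ ?_ ?_ ?_
  · exact (freeCard_update_none h i (mem_filter.mp hi).2).trans (by rw [hh])
  · intro i hi
    simp only [mem_filter, mem_univ, true_and]
    intro j hj
    by_cases hji : j = i
    · subst hji; simp at hj
    · simp [hji]
  · intro i hi j hj hij
    by_contra hne
    have := congrFun (congrArg Subtype.val hij) i
    simp only [Function.update_self, Function.update_of_ne hne] at this
    exact (mem_filter.mp hi).2 this.symm
  · intro g hg
    obtain ⟨i, hi, hig⟩ := exists_update_of_isCubeSubface (⟨h, hh⟩ : CubeCell n k) g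
      (mem_filter.mp hg).2
    exact ⟨i, by simpa using hi, Subtype.ext hig⟩
  · intro i hi
    exact chainExtend_apply x ⟨Function.update h i none, _⟩

/-- The cycles among the mixed chains supported on `k`-faces. -/
def homogeneousCycles (n k : ℕ) : Submodule (ZMod 2) ((Fin n → Option Bool) → ZMod 2) :=
  homogeneousChains n k ⊓ LinearMap.ker (totalBoundary n)

theorem map_chainExtend_ker (n k : ℕ) :
    (LinearMap.ker (cubeBoundary n (k + 1))).map (chainExtend n (k + 1)) =
      homogeneousCycles n (k + 1) := by
  have : LinearMap.ker (cubeBoundary n (k + 1)) =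
      (LinearMap.ker (totalBoundary n)).comap (chainExtend n (k + 1)) := by
    ext x
    rw [Submodule.mem_comap, LinearMap.mem_ker, LinearMap.mem_ker, totalBoundary_chainExtend]
    exact (map_eq_zero_iff _ (chainExtend_injective n k)).symm
  rw [this, Submodule.map_comap_eq, range_chainExtend, homogeneousCycles]

theorem finrank_ker_cubeBoundary (n k : ℕ) :
    Module.finrank (ZMod 2) (LinearMap.ker (cubeBoundary n (k + 1))) =
      Module.finrank (ZMod 2) (homogeneousCycles n (k + 1)) := by
  rw [← map_chainExtend_ker]
  exact (Submodule.equivMapOfInjective _ (chainExtend_injective n (k + 1)) _).finrank_eq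

/-- A `(k+1)`-cycle of the `(n+1)`-cube restricts to a chain on the facet where the first
coordinate is `0`, and its restrictions to the two opposite facets differ by a cycle. -/
def sliceCycles (n k : ℕ) :
    homogeneousCycles (n + 1) (k + 1) →ₗ[ZMod 2]
      homogeneousChains n (k + 1) × homogeneousCycles n (k + 1) :=
  LinearMap.prod
    (((slice n (some false)).comp (homogeneousCycles (n + 1) (k + 1)).subtype).codRestrict _
      fun x => slice_some_mem false x.2.1)
    (((slice n (some false) + slice n (some true)).comp
      (homogeneousCycles (n + 1) (k + 1)).subtype).codRestrict _ fun x => by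
        have h := (totalBoundary_eq_zero_iff x.1).mp x.2.2
        refine ⟨add_mem (slice_some_mem false x.2.1) (slice_some_mem true x.2.1), ?_⟩
        simp only [LinearMap.comp_apply, LinearMap.add_apply, Submodule.subtype_apply]
        rw [SetLike.mem_coe, LinearMap.mem_ker, map_add, h, h, CharTwo.add_self_eq_zero])

theorem sliceCycles_injective (n k : ℕ) : Function.Injective (sliceCycles n k) := by
  rw [injective_iff_map_eq_zero]
  intro x hx
  have h0 : slice n (some false) x.1 = 0 := congrArg (fun p => p.1.1) hx
  have h01 : slice n (some false) x.1 + slice n (some true) x.1 = 0 :=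
    congrArg (fun p => p.2.1) hx
  have h1 : slice n (some true) x.1 = 0 := by rwa [h0, zero_add] at h01
  have h := (totalBoundary_eq_zero_iff x.1).mp x.2.2 false
  rw [h0, map_zero] at h
  refine Subtype.ext (slice_ext fun o => ?_)
  rcases o with _ | _ | _
  · simpa using h.symm
  · simpa using h0
  · simpa using h1

theorem sliceCycles_surjective (n k : ℕ) : Function.Surjective (sliceCycles n k) := by
  rintro ⟨⟨b, hb⟩, ⟨z, hz, hDz⟩⟩
  rw [SetLike.mem_coe, LinearMap.mem_ker] at hDz
  let f : Option Bool → (Fin n → Option Bool) → ZMod 2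
    | none => totalBoundary n b
    | some false => b
    | some true => b + z
  let x : (Fin (n + 1) → Option Bool) → ZMod 2 := fun g => f (g 0) (Fin.tail g)
  have hx : ∀ o, slice n o x = f o := fun o => rfl
  have hmem : x ∈ homogeneousCycles (n + 1) (k + 1) := by
    constructor
    · intro g hg
      rw [← Fin.cons_self_tail g, freeCard_cons] at hg
      change f (g 0) (Fin.tail g) = 0
      rcases hg0 : g 0 with _ | _ | _ <;> simp only [hg0] at hg
      · exact totalBoundary_mem hb _ (by simp at hg; omega)
      · exact hb _ (by simpa using hg)
      · exact add_mem hb hz _ (by simpa using hg)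
    · refine (totalBoundary_eq_zero_iff x).mpr fun c => ?_
      rw [hx, hx]
      cases c
      · rfl
      · change totalBoundary n (b + z) = totalBoundary n b
        rw [map_add, hDz, add_zero]
  refine ⟨⟨x, hmem⟩, Prod.ext (Subtype.ext rfl) (Subtype.ext ?_)⟩
  change b + (b + z) = z
  rw [← add_assoc, CharTwo.add_self_eq_zero, zero_add]

theorem card_cubeCell_s9 (n k : ℕ) :
    Fintype.card (CubeCell n k) = n.choose k * 2 ^ (n - k) := by
  have hsum : ∀ n k : ℕ, Fintype.card (CubeCell n k) =
      ∑ g : Fin n → Option Bool, if freeCard g = k then 1 else 0 := fun n k => by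
    rw [Fintype.card_subtype, card_filter]
    rfl
  have hsucc : ∀ n k : ℕ, Fintype.card (CubeCell (n + 1) k) =
      (∑ g : Fin n → Option Bool, if 1 + freeCard g = k then 1 else 0) +
        2 * Fintype.card (CubeCell n k) := fun n k => by
    rw [hsum, hsum, ← (Fin.consEquiv fun _ => Option Bool).sum_comp, Fintype.sum_prod_type,
      Fintype.sum_option, Fintype.sum_bool]
    simp [Fin.consEquiv, freeCard_cons, two_mul]
  induction n generalizing k with
  | zero => cases k <;> simp [hsum, freeCard]
  | succ n ih =>
    rw [hsucc, ih]
    cases k with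
    | zero => simp [pow_succ, mul_comm]
    | succ k =>
      simp_rw [add_comm 1, add_left_inj]
      rw [← hsum, ih, Nat.choose_succ_succ, Nat.add_sub_add_right, add_mul]
      congr 1
      rcases lt_or_ge k n with h | h
      · rw [show n - k = n - (k + 1) + 1 by omega, pow_succ]
        ring
      · simp [Nat.choose_eq_zero_of_lt (Nat.lt_succ_of_le h)]

theorem finrank_homogeneousChains (n k : ℕ) :
    Module.finrank (ZMod 2) (homogeneousChains n k) = n.choose k * 2 ^ (n - k) := by
  rw [← range_chainExtend, LinearMap.finrank_range_of_inj (chainExtend_injective n k),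
    Module.finrank_fintype_fun_eq_card, card_cubeCell_s9]

theorem finrank_homogeneousCycles (n k : ℕ) :
    Module.finrank (ZMod 2) (homogeneousCycles n (k + 1)) =
      ∑ j ∈ Finset.range n, j.choose (k + 1) * 2 ^ (j - (k + 1)) := by
  induction n with
  | zero =>
    have : homogeneousCycles 0 (k + 1) = ⊥ := by
      refine (Submodule.eq_bot_iff _).mpr fun x hx => funext fun g => hx.1 g ?_
      simp [freeCard]
    rw [this, finrank_bot, sum_range_zero]
  | succ n ih =>
    rw [(LinearEquiv.ofBijective (sliceCycles n k)
      ⟨sliceCycles_injective n k, sliceCycles_surjective n k⟩).finrank_eq,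
      Module.finrank_prod, ih, finrank_homogeneousChains, sum_range_succ, add_comm]

/-- For `1 ≤ k ≤ n-1`, the `ℤ/2`-dimension of the cycle space `Z_k` of the
`n`-cube (the kernel of the boundary map `∂ₖ` on mod-2 `k`-chains) equals
`s(n,k) = Σ_{j=k}^{n-1} binomial (j,k) · 2^{j-k}`. -/
theorem cube_cycle_space_finrank (n k : ℕ) (hk : 1 ≤ k) (hkn : k ≤ n - 1) :
    Module.finrank (ZMod 2) (LinearMap.ker (cubeBoundary n k)) =
      ∑ j ∈ Finset.Ico k n, j.choose k * 2 ^ (j - k) := by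
  obtain ⟨k, rfl⟩ := Nat.exists_eq_add_of_le' hk
  rw [finrank_ker_cubeBoundary, finrank_homogeneousCycles,
    ← sum_range_add_sum_Ico _ (show k + 1 ≤ n by omega), sum_eq_zero, zero_add]
  intro j hj
  rw [Nat.choose_eq_zero_of_lt (mem_range.mp hj), zero_mul]
end

section
/- For all integers n, k with 1 ≤ k ≤ n−1, the following integer identity holds: Σ_{j=k}^{n−1} binomial(j, k) · 2^{j−k} = (−1)^{k+1} + Σ_{j=0}^{k} (−1)^{k−j} · binomial(n, j) · 2^{n−j}. -/
theorem sum_Ico_choose_mul_two_pow_eq_sum_range (n k : ℕ) :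
    ∑ j ∈ Finset.Ico k n, (j.choose k : ℤ) * 2 ^ (j - k) =
      ∑ j ∈ Finset.range n, (j.choose k : ℤ) * 2 ^ (j - k) := by
  apply Finset.sum_subset
  · intro j hj
    simp only [Finset.mem_Ico, Finset.mem_range] at hj ⊢
    exact hj.2
  · intro j hj hj'
    simp only [Finset.mem_Ico, Finset.mem_range] at hj hj'
    rw [Nat.choose_eq_zero_of_lt (by omega)]
    simp

theorem choose_succ_mul_two_pow_succ (n k : ℕ) :
    ((n + 1).choose (k + 1) : ℤ) * 2 ^ (n - k) =
      n.choose k * 2 ^ (n - k) + 2 * (n.choose (k + 1) * 2 ^ (n - (k + 1))) := by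
  rw [Nat.choose_succ_succ]
  rcases Nat.lt_or_ge k n with h | h
  · obtain ⟨d, rfl⟩ := Nat.exists_eq_add_of_lt h
    rw [show k + d + 1 - k = d + 1 by omega, show k + d + 1 - (k + 1) = d by omega]
    push_cast
    ring
  · simp [Nat.choose_eq_zero_of_lt (Nat.lt_succ_of_le h)]

theorem sum_range_choose_mul_two_pow_add_succ (n k : ℕ) :
    ∑ j ∈ Finset.range n, (j.choose k : ℤ) * 2 ^ (j - k) +
        ∑ j ∈ Finset.range n, (j.choose (k + 1) : ℤ) * 2 ^ (j - (k + 1)) =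
      n.choose (k + 1) * 2 ^ (n - (k + 1)) := by
  induction n with
  | zero => simp
  | succ n ih =>
    rw [Finset.sum_range_succ, Finset.sum_range_succ, Nat.add_sub_add_right]
    linarith [choose_succ_mul_two_pow_succ n k]

theorem sum_range_choose_mul_two_pow_eq_alternating_sum (n k : ℕ) :
    ∑ j ∈ Finset.range n, (j.choose k : ℤ) * 2 ^ (j - k) =
      (-1 : ℤ) ^ (k + 1) +
        ∑ j ∈ Finset.range (k + 1), (-1 : ℤ) ^ (k - j) * n.choose j * 2 ^ (n - j) := by
  induction k with
  | zero =>
    have h := geom_sum_mul (2 : ℤ) n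
    simp only [Nat.choose_zero_right, Nat.sub_zero, Nat.cast_one, one_mul, zero_add,
      Finset.sum_range_one, pow_zero, pow_one]
    linarith
  | succ k ih =>
    have hneg : ∑ j ∈ Finset.range (k + 1),
          (-1 : ℤ) ^ (k + 1 - j) * n.choose j * 2 ^ (n - j) =
        -∑ j ∈ Finset.range (k + 1), (-1 : ℤ) ^ (k - j) * n.choose j * 2 ^ (n - j) := by
      rw [← Finset.sum_neg_distrib]
      refine Finset.sum_congr rfl fun j hj => ?_
      rw [Nat.succ_sub (Finset.mem_range_succ_iff.mp hj), pow_succ]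
      ring
    rw [Finset.sum_range_succ _ (k + 1), hneg, Nat.sub_self, pow_zero, one_mul,
      pow_succ _ (k + 1)]
    linarith [sum_range_choose_mul_two_pow_add_succ n k]

/-- For `1 ≤ k ≤ n-1`, the integer identity
`Σ_{j=k}^{n-1} binomial (j,k) · 2^{j-k}
  = (−1)^{k+1} + Σ_{j=0}^{k} (−1)^{k−j} · binomial (n,j) · 2^{n−j}`
holds; the left side is `s(n,k)`, the cardinality of the cube sphere basis, and the right side
is `m(n,k)`, the Euler–Poincaré expression for the `k`-th mod-2 Betti number of the
`k`-skeleton of the `n`-cube. -/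
theorem cube_basis_card_eq_euler_poincare (n k : ℕ) (hk : 1 ≤ k) (hkn : k ≤ n - 1) :
    ∑ j ∈ Finset.Ico k n, (j.choose k : ℤ) * 2 ^ (j - k) =
      (-1 : ℤ) ^ (k + 1) +
        ∑ j ∈ Finset.range (k + 1), (-1 : ℤ) ^ (k - j) * n.choose j * 2 ^ (n - j) := by
  rw [sum_Ico_choose_mul_two_pow_eq_sum_range, sum_range_choose_mul_two_pow_eq_alternating_sum]
end

section
/- For all integers n, k with 1 ≤ k ≤ n, the following integer identity holds: Σ_{i=k}^{n} binomial(n, i) · binomial(i−1, k−1) = Σ_{i=k}^{n} (−1)^{k+i} · 2^{n−i} · binomial(n, i). -/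
theorem sum_Ico_choose_mul_choose {n k : ℕ} (hkn : k ≤ n) :
    ∑ i ∈ Finset.Ico k (n + 1), (n.choose i : ℤ) * i.choose k =
      2 ^ (n - k) * n.choose k := by
  have h : ∀ i ∈ Finset.range (n + 1 - k), (n.choose (k + i) : ℤ) * (k + i).choose k =
      n.choose k * (n - k).choose i := by
    intro i hi
    rw [Finset.mem_range] at hi
    have := Nat.choose_mul (n := n) (k := k + i) (s := k) (by lia)
    rw [Nat.add_sub_cancel_left] at this
    exact_mod_cast this
  rw [Finset.sum_Ico_eq_sum_range, Finset.sum_congr rfl h, ← Finset.mul_sum,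
    Nat.sub_add_comm hkn, mul_comm]
  congr 1
  exact_mod_cast Nat.sum_range_choose (n - k)

theorem sum_Ico_choose_mul_choose_pred_add {n k : ℕ} (hk : 1 ≤ k) (hkn : k ≤ n) :
    ∑ i ∈ Finset.Ico k (n + 1), (n.choose i : ℤ) * (i - 1).choose (k - 1) +
      ∑ i ∈ Finset.Ico (k + 1) (n + 1), (n.choose i : ℤ) * (i - 1).choose k =
      2 ^ (n - k) * n.choose k := by
  have h : ∑ i ∈ Finset.Ico k (n + 1), (n.choose i : ℤ) * (i - 1).choose k =
      ∑ i ∈ Finset.Ico (k + 1) (n + 1), (n.choose i : ℤ) * (i - 1).choose k := by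
    rw [Finset.sum_eq_sum_Ico_succ_bot (by lia), Nat.choose_eq_zero_of_lt (by lia : k - 1 < k)]
    simp
  rw [← h, ← Finset.sum_add_distrib, ← sum_Ico_choose_mul_choose hkn]
  refine Finset.sum_congr rfl fun i hi => ?_
  rw [Finset.mem_Ico] at hi
  obtain ⟨j, rfl⟩ : ∃ j, i = j + 1 := ⟨i - 1, by lia⟩
  obtain ⟨l, rfl⟩ : ∃ l, k = l + 1 := ⟨k - 1, by lia⟩
  simp only [Nat.add_sub_cancel, Nat.choose_succ_succ j l]
  push_cast
  ring

theorem sum_Ico_neg_one_pow_mul_two_pow_add {n k : ℕ} (hkn : k ≤ n) :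
    ∑ i ∈ Finset.Ico k (n + 1), (-1 : ℤ) ^ (k + i) * 2 ^ (n - i) * n.choose i +
      ∑ i ∈ Finset.Ico (k + 1) (n + 1), (-1 : ℤ) ^ (k + 1 + i) * 2 ^ (n - i) * n.choose i =
      2 ^ (n - k) * n.choose k := by
  rw [Finset.sum_eq_sum_Ico_succ_bot (by lia), add_assoc, ← Finset.sum_add_distrib,
    Finset.sum_eq_zero fun i _ => by ring, Even.neg_one_pow ⟨k, rfl⟩]
  ring

theorem sum_Ico_choose_mul_choose_pred {n k : ℕ} (hk : 1 ≤ k) (hkn : k ≤ n + 1) :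
    ∑ i ∈ Finset.Ico k (n + 1), (n.choose i : ℤ) * (i - 1).choose (k - 1) =
      ∑ i ∈ Finset.Ico k (n + 1), (-1 : ℤ) ^ (k + i) * 2 ^ (n - i) * n.choose i := by
  induction hkn using Nat.decreasingInduction with
  | self => simp
  | of_succ k hkn ih =>
    have hB := sum_Ico_choose_mul_choose_pred_add hk (Nat.le_of_lt_succ hkn)
    have hG := sum_Ico_neg_one_pow_mul_two_pow_add (Nat.le_of_lt_succ hkn)
    have h := ih (by lia)
    rw [Nat.add_sub_cancel] at h
    linarith


/-- For `1 ≤ k ≤ n`, the integer identity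
`Σ_{i=k}^{n} binomial (n,i) · binomial (i−1, k−1)
  = Σ_{i=k}^{n} (−1)^{k+i} · 2^{n−i} · binomial (n,i)`
holds; the left side is `bw(n,k)` (the Björner–Welker rank formula for the cohomology of
no-`k`-equal space) and the right side is `gr(n,k)` (Green's alternating-sum formula). -/
theorem bw_eq_gr (n k : ℕ) (hk : 1 ≤ k) (hkn : k ≤ n) :
    ∑ i ∈ Finset.Icc k n, (n.choose i : ℤ) * (i - 1).choose (k - 1) =
      ∑ i ∈ Finset.Icc k n, (-1 : ℤ) ^ (k + i) * 2 ^ (n - i) * n.choose i := by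
  have h : Finset.Icc k n = Finset.Ico k (n + 1) := by
    ext i
    simp only [Finset.mem_Icc, Finset.mem_Ico]
    lia
  rw [h]
  exact sum_Ico_choose_mul_choose_pred hk (by lia)
end

section
/- For every integer n ≥ 3, Σ_{i=3}^{n} binomial(n, i) · binomial(i−1, 2) = Σ_{j=2}^{n−1} binomial(j, 2) · 2^{j−2}; that is, bw(n,3) = s(n,2). -/
open Finset in
theorem sum_choose_mul_choose (n k : ℕ) :
    ∑ i ∈ range (n + 1), n.choose i * i.choose k = n.choose k * 2 ^ (n - k) := by
  rcases lt_or_ge n k with h | h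
  · rw [Nat.choose_eq_zero_of_lt h, zero_mul]
    refine sum_eq_zero fun i hi => ?_
    rw [Nat.choose_eq_zero_of_lt (show i < k by grind), mul_zero]
  · obtain ⟨m, rfl⟩ := Nat.exists_eq_add_of_le h
    rw [add_assoc, sum_range_add, sum_eq_zero, zero_add, Nat.add_sub_cancel_left,
      ← Nat.sum_range_choose, mul_sum]
    · refine sum_congr rfl fun i _ => ?_
      rw [Nat.choose_mul (Nat.le_add_right k i), Nat.add_sub_cancel_left, Nat.add_sub_cancel_left]
    · intro i hi
      rw [Nat.choose_eq_zero_of_lt (mem_range.mp hi), mul_zero]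

open Finset in
theorem sum_choose_succ_mul_choose (n k : ℕ) :
    ∑ i ∈ range n, n.choose (i + 1) * i.choose k =
      ∑ j ∈ range n, j.choose k * 2 ^ (j - k) := by
  induction n with
  | zero => rfl
  | succ n ih =>
    simp_rw [Nat.choose_succ_succ', add_mul, sum_add_distrib]
    rw [sum_choose_mul_choose, sum_range_succ (fun i => n.choose (i + 1) * i.choose k),
      Nat.choose_succ_self, zero_mul, add_zero, ih, sum_range_succ, add_comm]

/-- For every `n ≥ 3`,
`Σ_{i=3}^{n} binomial (n,i) · binomial (i−1, 2) = Σ_{j=2}^{n-1} binomial (j,2) · 2^{j-2}`;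
that is, `bw(n,3) = s(n,2)`. -/
theorem bw_three_eq_s_two (n : ℕ) (hn : 3 ≤ n) :
    ∑ i ∈ Finset.Icc 3 n, n.choose i * (i - 1).choose 2 =
      ∑ j ∈ Finset.Ico 2 n, j.choose 2 * 2 ^ (j - 2) := by
  have h := sum_choose_succ_mul_choose n 2
  have hn' : 2 ≤ n := by omega
  rw [← Finset.sum_range_add_sum_Ico _ hn', ← Finset.sum_range_add_sum_Ico _ hn'] at h
  simp only [Finset.sum_range_succ, Finset.sum_range_zero, Nat.choose_eq_zero_of_lt Nat.zero_lt_two,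
    Nat.choose_eq_zero_of_lt Nat.one_lt_two, mul_zero, zero_mul, zero_add] at h
  rw [← h, ← Finset.Ico_add_one_right_eq_Icc,
    ← Finset.sum_Ico_add' (fun i => n.choose i * (i - 1).choose 2) 2 n 1]
  rfl
end
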